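/- arXiv:2111.02918 — 2 statements merged into one kernel-verified Lean document; each statement's English description precedes it below -/
import Mathlib

section
/- Let u: ℝⁿ → [0, ∞] be a Borel function and F ⊆ ℝⁿ a continuum. Suppose there is a > 0 such that for each y ∈ F there exists a set D_y ⊆ S^{n-1}(y, 1) (the unit sphere centered at y) with H^{n-1}(D_y) ≥ a, such that ∫_{[y,w]} u ds ≥ 1 for each w ∈ D_y, where [y,w] is the line segment from y to w. Then ∫_{ℝⁿ} uⁿ ≥ c(n, a) · diam(F) for a constant c(n,a) > 0 depending only on n and a. -/
open MeasureTheory Set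
open scoped ENNReal

/-- An Eilenberg-type inequality: the `d`-dimensional Hausdorff measure of a subset of the unit
sphere is controlled by the `(d + 1)`-dimensional Hausdorff measure of the truncated cone over
it. -/
theorem hausdorffMeasure_le_cone {E : Type*} [NormedAddCommGroup E] [NormedSpace ℝ E]
    [MeasurableSpace E] [BorelSpace E] {d : ℝ} (hd : 0 ≤ d) {A : Set E}
    (hA : A ⊆ Metric.sphere 0 1) :
    μH[d] A ≤ 2 ^ (d + 1) * μH[d + 1] {x | ∃ t ∈ Ioo (1 / 2 : ℝ) 1, ∃ w ∈ A, x = t • w} := by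
  set K := {x : E | ∃ t ∈ Ioo (1 / 2 : ℝ) 1, ∃ w ∈ A, x = t • w} with hK
  have h2 : (2 : ℝ≥0∞) ^ (d + 1) = 2 * 2 ^ d := by
    rw [ENNReal.rpow_add _ _ (by simp) (by simp), ENNReal.rpow_one, mul_comm]
  have h20 : (2 : ℝ≥0∞) ^ (d + 1) ≠ 0 := by simp
  have h2t : (2 : ℝ≥0∞) ^ (d + 1) ≠ ∞ := by simp [ENNReal.rpow_eq_top_iff]
  rw [Measure.hausdorffMeasure_apply]
  refine iSup₂_le fun r hr => ?_
  set I := ⨅ (t : ℕ → Set E) (_ : A ⊆ ⋃ n, t n) (_ : ∀ n, Metric.ediam (t n) ≤ r),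
          ∑' n, ⨆ _ : (t n).Nonempty, Metric.ediam (t n) ^ d with hI
  have hr2 : 0 < r / 2 := ENNReal.half_pos hr.ne'
  have key : I / 2 ^ (d + 1) ≤ μH[d + 1] K := by
    rw [Measure.hausdorffMeasure_apply]
    refine le_trans ?_ (le_iSup₂ (r / 2) hr2)
    refine le_iInf₂ fun S hS => le_iInf fun hSd => ?_
    rw [ENNReal.div_le_iff h20 h2t]
    let J : ℕ → Set ℝ := fun i => closure (norm '' S i)
    have hJ : ∀ i, volume (J i) ≤ Metric.ediam (S i) := fun i =>
      (Real.volume_le_diam _).trans <| by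
        rw [Metric.ediam_closure]
        simpa using lipschitzWith_one_norm.ediam_image_le (S i)
    have hpt : ∀ t ∈ Ioo (1 / 2 : ℝ) 1,
        I ≤ ∑' i, (J i).indicator (fun _ => (2 * Metric.ediam (S i)) ^ d) t := by
      intro t ht
      have ht0 : 0 < t := by linarith [ht.1]
      let T : ℕ → Set E := fun i => {w | w ∈ A ∧ t • w ∈ S i}
      have hT : ∀ i, Metric.ediam (T i) ≤ 2 * Metric.ediam (S i) := by
        intro i
        refine Metric.ediam_le fun v hv w hw => ?_
        have h1 : edist (t • v) (t • w) ≤ Metric.ediam (S i) :=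
          Metric.edist_le_ediam_of_mem hv.2 hw.2
        have h3 : edist v w ≤ 2 * edist (t • v) (t • w) := by
          rw [edist_dist, edist_dist, dist_smul₀, ← ENNReal.ofReal_ofNat 2,
            ← ENNReal.ofReal_mul (by norm_num)]
          refine ENNReal.ofReal_le_ofReal ?_
          rw [Real.norm_of_nonneg ht0.le]
          nlinarith [ht.1, dist_nonneg (x := v) (y := w)]
        exact h3.trans (by gcongr)
      refine (iInf₂_le_of_le T ?_ (iInf_le_of_le ?_ le_rfl)).trans ?_
      · intro w hw
        obtain ⟨i, hi⟩ := mem_iUnion.1 (hS (show t • w ∈ K from ⟨t, ht, w, hw, rfl⟩))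
        exact mem_iUnion.2 ⟨i, hw, hi⟩
      · intro i
        refine (hT i).trans ((mul_le_mul_right (hSd i) 2).trans_eq ?_)
        exact ENNReal.mul_div_cancel (by simp) (by simp)
      · refine ENNReal.tsum_le_tsum fun i => iSup_le fun ⟨w, hw, hwS⟩ => ?_
        have : t ∈ J i := subset_closure ⟨t • w, hwS, by
          rw [norm_smul, mem_sphere_zero_iff_norm.1 (hA hw), Real.norm_of_nonneg ht0.le, mul_one]⟩
        rw [indicator_of_mem this]
        exact ENNReal.rpow_le_rpow (hT i) hd
    have hint : I * volume (Ioo (1 / 2 : ℝ) 1)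
        ≤ ∑' i, (2 * Metric.ediam (S i)) ^ d * volume (J i) := by
      calc I * volume (Ioo (1 / 2 : ℝ) 1) = ∫⁻ _ in Ioo (1 / 2 : ℝ) 1, I := by simp
        _ ≤ ∫⁻ t in Ioo (1 / 2 : ℝ) 1,
            ∑' i, (J i).indicator (fun _ => (2 * Metric.ediam (S i)) ^ d) t :=
          setLIntegral_mono' measurableSet_Ioo hpt
        _ ≤ ∫⁻ t, ∑' i, (J i).indicator (fun _ => (2 * Metric.ediam (S i)) ^ d) t :=
          setLIntegral_le_lintegral _ _
        _ = _ := by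
          rw [lintegral_tsum fun i =>
            (measurable_const.indicator isClosed_closure.measurableSet).aemeasurable]
          exact tsum_congr fun i => lintegral_indicator_const isClosed_closure.measurableSet _
    have hterm : ∀ i, (2 * Metric.ediam (S i)) ^ d * volume (J i)
        ≤ 2 ^ d * ⨆ _ : (S i).Nonempty, Metric.ediam (S i) ^ (d + 1) := by
      intro i
      rcases (S i).eq_empty_or_nonempty with h | h
      · simp [J, h]
      · rw [iSup_pos h, ENNReal.mul_rpow_of_nonneg _ _ hd, mul_assoc,
          ENNReal.rpow_add_of_nonneg _ _ hd zero_le_one, ENNReal.rpow_one]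
        gcongr
        exact hJ i
    have hv : volume (Ioo (1 / 2 : ℝ) 1) = 2⁻¹ := by
      rw [Real.volume_Ioo, show (1 - 1 / 2 : ℝ) = 2⁻¹ by norm_num,
        ENNReal.ofReal_inv_of_pos (by norm_num)]
      simp
    have := hint.trans (ENNReal.tsum_le_tsum hterm)
    rw [ENNReal.tsum_mul_left, hv, ← div_eq_mul_inv,
      ENNReal.div_le_iff (by simp) (by simp)] at this
    rw [h2]
    calc I ≤ _ := this
      _ = _ := by ring
  rw [ENNReal.div_le_iff h20 h2t] at key
  rwa [mul_comm]

/-- A connected set all of whose points are centres of balls of mass comparable to the radius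
has diameter bounded by the total mass. -/
theorem IsPreconnected.mul_ediam_le_measure_univ {X : Type*} [MetricSpace X]
    [TopologicalSpace.SeparableSpace X] [MeasurableSpace X] [OpensMeasurableSpace X]
    (ν : Measure X) {F : Set X} (hF : IsPreconnected F) {ε R : ℝ} (hε : 0 ≤ ε)
    (h : ∀ y ∈ F, ∃ r ∈ Ioc 0 R, ENNReal.ofReal (ε * r) ≤ ν (Metric.closedBall y r)) :
    ENNReal.ofReal ε * Metric.ediam F ≤ 10 * ν univ := by
  choose! r hr hν using h
  obtain ⟨V, hVF, hVd, hV⟩ := Vitali.exists_disjoint_subfamily_covering_enlargement_closedBall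
    F id r R (fun y hy => (hr y hy).2) 5 (by norm_num)
  have hVc : V.Countable := hVd.countable_of_nonempty_interior fun y hy =>
    ⟨y, Metric.ball_subset_interior_closedBall (Metric.mem_ball_self (hr y (hVF hy)).1)⟩
  have hdiam : Metric.ediam F ≤ ∑' b : V, ENNReal.ofReal (10 * r b) := by
    refine Metric.ediam_le fun x hx z hz => ?_
    have hcov : Icc 0 (dist x z) ⊆
        ⋃ b ∈ V, Icc (dist x b - 5 * r b) (dist x b + 5 * r b) := by
      have himg := (hF.image (dist x) (by fun_prop)).Icc_subset
        ⟨x, hx, dist_self x⟩ ⟨z, hz, rfl⟩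
      intro t ht
      obtain ⟨p, hp, rfl⟩ := himg ht
      obtain ⟨b, hb, hsub⟩ := hV p hp
      have hpb : dist p b ≤ 5 * r b := hsub (Metric.mem_closedBall_self (hr p hp).1.le)
      refine mem_iUnion₂.2 ⟨b, hb, ?_, ?_⟩
      · linarith [dist_triangle x p b]
      · linarith [dist_triangle x b p, dist_comm p b]
    calc edist x z = volume (Icc 0 (dist x z)) := by rw [Real.volume_Icc, sub_zero, edist_dist]
      _ ≤ _ := measure_mono hcov
      _ ≤ ∑' b : V, volume (Icc (dist x b - 5 * r b) (dist x b + 5 * r b)) :=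
        measure_biUnion_le _ hVc _
      _ = _ := by
        congr 1 with b
        rw [Real.volume_Icc]
        ring_nf
  calc ENNReal.ofReal ε * Metric.ediam F
      ≤ ENNReal.ofReal ε * ∑' b : V, ENNReal.ofReal (10 * r b) := by gcongr
    _ = 10 * ∑' b : V, ENNReal.ofReal (ε * r b) := by
      rw [← ENNReal.tsum_mul_left, ← ENNReal.tsum_mul_left]
      congr 1 with b
      rw [ENNReal.ofReal_mul (by norm_num), ENNReal.ofReal_mul hε, ENNReal.ofReal_ofNat]
      ring
    _ ≤ 10 * ∑' b : V, ν (Metric.closedBall b (r b)) := by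
      gcongr with b
      exact hν b (hVF b.2)
    _ = 10 * ν (⋃ b ∈ V, Metric.closedBall b (r b)) := by
      rw [measure_biUnion hVc (by simpa using hVd) fun _ _ =>
        Metric.isClosed_closedBall.measurableSet]
    _ ≤ 10 * ν univ := by
      gcongr
      exact subset_univ _

theorem lintegral_comp_smul_addHaar {E : Type*} [NormedAddCommGroup E] [NormedSpace ℝ E]
    [MeasurableSpace E] [BorelSpace E] [FiniteDimensional ℝ E] (μ : Measure E)
    [μ.IsAddHaarMeasure] {r : ℝ} (hr : 0 < r) (g : E → ℝ≥0∞) :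
    ∫⁻ x, g (r • x) ∂μ = ENNReal.ofReal ((r ^ Module.finrank ℝ E)⁻¹) * ∫⁻ x, g x ∂μ := by
  have h := (Homeomorph.smulOfNeZero r hr.ne').measurableEmbedding.lintegral_map (μ := μ) g
  have h2 : μ.map (Homeomorph.smulOfNeZero r hr.ne')
      = ENNReal.ofReal |(r ^ Module.finrank ℝ E)⁻¹| • μ := Measure.map_addHaar_smul μ hr.ne'
  rw [h2, lintegral_smul_measure, abs_of_pos (by positivity)] at h
  simpa using h.symm

/-- The integral of `u` over the unit segment in direction `v` is at most its integral along
the shortened direction `t • v` over a parameter interval of length two. -/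
theorem lintegral_segment_le_lintegral_ray {E : Type*} [NormedAddCommGroup E] [NormedSpace ℝ E]
    (u : E → ℝ≥0∞) (y v : E) {t : ℝ} (ht : t ∈ Ioo (1 / 2 : ℝ) 1) :
    ∫⁻ s in Icc (0 : ℝ) 1, u (y + s • v) ≤ ∫⁻ s in Ioc (0 : ℝ) 2, u (y + s • t • v) := by
  have ht0 : 0 < t := by linarith [ht.1]
  rw [setLIntegral_congr Ioc_ae_eq_Icc.symm, ← lintegral_indicator measurableSet_Ioc,
    ← lintegral_indicator measurableSet_Ioc]
  have h := lintegral_comp_smul_addHaar (volume : Measure ℝ) ht0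
    ((Ioc (0 : ℝ) 1).indicator fun s => u (y + s • v))
  calc _ ≤ ENNReal.ofReal ((t ^ Module.finrank ℝ ℝ)⁻¹) *
        ∫⁻ s, (Ioc (0 : ℝ) 1).indicator (fun s => u (y + s • v)) s := by
        refine le_mul_of_one_le_left zero_le ?_
        rw [ENNReal.one_le_ofReal, Module.finrank_self, pow_one]
        exact (one_le_inv₀ ht0).2 ht.2.le
    _ = _ := h.symm
    _ ≤ _ := by
      refine lintegral_mono fun s => ?_
      by_cases hs : t • s ∈ Ioc (0 : ℝ) 1
      swap
      · rw [indicator_of_notMem hs]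
        exact zero_le
      have hs1 : t * s ∈ Ioc (0 : ℝ) 1 := hs
      have hs0 : 0 < s := pos_of_mul_pos_right hs1.1 ht0.le
      rw [indicator_of_mem (show s ∈ Ioc (0 : ℝ) 2 from ⟨hs0, by nlinarith [ht.1, hs1.2]⟩),
        indicator_of_mem hs, smul_smul, smul_eq_mul, mul_comm]

/-- Elementary form of Hölder's inequality against a constant. -/
theorem ENNReal.le_ofReal_add_mul_pow {n : ℕ} (hn : n ≠ 0) {τ : ℝ} (hτ : 0 < τ) (x : ℝ≥0∞) :
    x ≤ ENNReal.ofReal τ + ENNReal.ofReal ((τ ^ (n - 1))⁻¹) * x ^ n := by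
  obtain ⟨m, rfl⟩ := Nat.exists_eq_succ_of_ne_zero hn
  rcases le_total x (ENNReal.ofReal τ) with h | h
  · exact h.trans le_self_add
  · refine le_trans ?_ le_add_self
    have h1 : 1 ≤ ENNReal.ofReal ((τ ^ m)⁻¹) * x ^ m := by
      calc (1 : ℝ≥0∞) = ENNReal.ofReal ((τ ^ m)⁻¹) * ENNReal.ofReal τ ^ m := by
            rw [← ENNReal.ofReal_pow hτ.le, ← ENNReal.ofReal_mul (by positivity),
              inv_mul_cancel₀ (by positivity), ENNReal.ofReal_one]
        _ ≤ _ := by gcongr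
    calc x = 1 * x := (one_mul x).symm
      _ ≤ (ENNReal.ofReal ((τ ^ m)⁻¹) * x ^ m) * x := by gcongr
      _ = _ := by rw [Nat.succ_sub_one, pow_succ, mul_assoc]

theorem lintegral_unitBall_comp_le {n : ℕ} (hn : n ≠ 0) {u : EuclideanSpace ℝ (Fin n) → ℝ≥0∞}
    (y : EuclideanSpace ℝ (Fin n)) {δ s : ℝ} (hδ : 0 < δ) (hs : 0 < s)
    (h : ∫⁻ x in Metric.closedBall y s, u x ^ n ≤ ENNReal.ofReal (δ ^ n * s)) :
    ∫⁻ x in Metric.closedBall 0 1, u (y + s • x)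
      ≤ ENNReal.ofReal δ * (volume (Metric.closedBall (0 : EuclideanSpace ℝ (Fin n)) 1) + 1) *
        ENNReal.ofReal (s ^ ((n : ℝ)⁻¹ - 1)) := by
  set σ : ℝ := s ^ ((n : ℝ)⁻¹ - 1) with hσ
  have hσ0 : 0 < σ := by positivity
  have hσn : σ ^ n * s ^ n = s := by
    rw [hσ, ← mul_pow, ← Real.rpow_add_one hs.ne', sub_add_cancel,
      Real.rpow_inv_natCast_pow hs.le hn]
  have hscale : ∫⁻ x in Metric.closedBall 0 1, u (y + s • x) ^ n
      = ENNReal.ofReal ((s ^ n)⁻¹) * ∫⁻ x in Metric.closedBall y s, u x ^ n := by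
    have h1 := lintegral_comp_smul_addHaar (volume : Measure (EuclideanSpace ℝ (Fin n))) hs
      (fun x => (Metric.closedBall y s).indicator (fun x => u x ^ n) (y + x))
    rw [lintegral_add_left_eq_self (μ := volume)
      ((Metric.closedBall y s).indicator fun x => u x ^ n) y,
      lintegral_indicator Metric.isClosed_closedBall.measurableSet,
      finrank_euclideanSpace_fin] at h1
    rw [← h1, ← lintegral_indicator Metric.isClosed_closedBall.measurableSet]
    congr 1 with x
    have hiff : y + s • x ∈ Metric.closedBall y s ↔ x ∈ Metric.closedBall 0 1 := by
      simp [norm_smul, abs_of_pos hs, hs]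
    by_cases hx : x ∈ Metric.closedBall 0 1
    · rw [indicator_of_mem hx, indicator_of_mem (hiff.2 hx)]
    · rw [indicator_of_notMem hx, indicator_of_notMem (mt hiff.1 hx)]
  calc ∫⁻ x in Metric.closedBall 0 1, u (y + s • x)
      ≤ ∫⁻ x in Metric.closedBall 0 1, (ENNReal.ofReal (δ * σ) +
          ENNReal.ofReal (((δ * σ) ^ (n - 1))⁻¹) * u (y + s • x) ^ n) :=
        lintegral_mono fun x => ENNReal.le_ofReal_add_mul_pow hn (by positivity) _
    _ = ENNReal.ofReal (δ * σ) * volume (Metric.closedBall (0 : EuclideanSpace ℝ (Fin n)) 1) +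
        ENNReal.ofReal (((δ * σ) ^ (n - 1))⁻¹) *
          (ENNReal.ofReal ((s ^ n)⁻¹) * ∫⁻ x in Metric.closedBall y s, u x ^ n) := by
        rw [lintegral_add_left measurable_const, lintegral_const_mul' _ _ ENNReal.ofReal_ne_top,
          hscale, setLIntegral_const]
    _ ≤ ENNReal.ofReal (δ * σ) * volume (Metric.closedBall (0 : EuclideanSpace ℝ (Fin n)) 1) +
        ENNReal.ofReal (((δ * σ) ^ (n - 1))⁻¹) *
          (ENNReal.ofReal ((s ^ n)⁻¹) * ENNReal.ofReal (δ ^ n * s)) := by gcongr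
    _ = ENNReal.ofReal (δ * σ) * volume (Metric.closedBall (0 : EuclideanSpace ℝ (Fin n)) 1) +
        ENNReal.ofReal (δ * σ) := by
        rw [← ENNReal.ofReal_mul (by positivity), ← ENNReal.ofReal_mul (by positivity)]
        congr 2
        have e : δ ^ n * s = (δ * σ) ^ (n - 1) * (δ * σ) * s ^ n := by
          rw [pow_sub_one_mul hn, mul_pow, mul_assoc, hσn]
        rw [e]
        field_simp
    _ = _ := by
        rw [ENNReal.ofReal_mul hδ.le]
        ring

/-- If the segments emanating from `y` that carry `u`-length at least one fill a definite volume,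
then `u ^ n` has mass comparable to `r` on some ball of radius `r ≤ 2` about `y`. -/
theorem exists_closedBall_lt_lintegral_pow {n : ℕ} (hn : n ≠ 0) {κ : ℝ≥0∞} (hκ : 0 < κ) :
    ∃ ε : ℝ, 0 < ε ∧ ∀ u : EuclideanSpace ℝ (Fin n) → ℝ≥0∞, Measurable u → ∀ y,
      κ ≤ volume {x ∈ Metric.closedBall (0 : EuclideanSpace ℝ (Fin n)) 1 |
        1 ≤ ∫⁻ s in Ioc (0 : ℝ) 2, u (y + s • x)} →
      ∃ r ∈ Ioc (0 : ℝ) 2, ENNReal.ofReal (ε * r) < ∫⁻ x in Metric.closedBall y r, u x ^ n := by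
  set M : ℝ≥0∞ := (volume (Metric.closedBall (0 : EuclideanSpace ℝ (Fin n)) 1) + 1) *
    ∫⁻ s in Ioc (0 : ℝ) 2, ENNReal.ofReal (s ^ ((n : ℝ)⁻¹ - 1)) with hM
  have hMt : M ≠ ∞ := by
    refine ENNReal.mul_ne_top
      (ENNReal.add_ne_top.2 ⟨measure_closedBall_lt_top.ne, ENNReal.one_ne_top⟩) ?_
    have hn' : 0 < (n : ℝ)⁻¹ := by positivity
    have := (intervalIntegrable_iff_integrableOn_Ioc_of_le zero_le_two).1
      (intervalIntegral.intervalIntegrable_rpow' (a := 0) (b := 2)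
        (show -1 < (n : ℝ)⁻¹ - 1 by linarith))
    exact this.lintegral_lt_top.ne
  obtain ⟨δ, hδ0, hδ⟩ : ∃ δ : ℝ, 0 < δ ∧ ENNReal.ofReal δ * M < κ := by
    have hlim : Filter.Tendsto (fun δ : ℝ => ENNReal.ofReal δ * M) (nhdsWithin 0 (Ioi 0))
        (nhds 0) := by
      have h0 : Filter.Tendsto ENNReal.ofReal (nhdsWithin 0 (Ioi 0)) (nhds 0) := by
        simpa using (ENNReal.continuous_ofReal.tendsto 0).mono_left nhdsWithin_le_nhds
      simpa using ENNReal.Tendsto.mul_const h0 (Or.inr hMt)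
    obtain ⟨δ, h1, h2⟩ := ((hlim.eventually (gt_mem_nhds hκ)).and self_mem_nhdsWithin).exists
    exact ⟨δ, h2, h1⟩
  refine ⟨δ ^ n, by positivity, fun u hu y hy => ?_⟩
  by_contra! hcon
  have hmeas : Measurable fun p : EuclideanSpace ℝ (Fin n) × ℝ => u (y + p.2 • p.1) :=
    hu.comp (by fun_prop)
  refine absurd (hy.trans ?_) (not_le.2 hδ)
  calc volume {x ∈ Metric.closedBall (0 : EuclideanSpace ℝ (Fin n)) 1 |
        1 ≤ ∫⁻ s in Ioc (0 : ℝ) 2, u (y + s • x)}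
      ≤ volume.restrict (Metric.closedBall (0 : EuclideanSpace ℝ (Fin n)) 1)
          {x | 1 ≤ ∫⁻ s in Ioc (0 : ℝ) 2, u (y + s • x)} := by
        rw [Measure.restrict_apply' Metric.isClosed_closedBall.measurableSet, inter_comm]
        rfl
    _ ≤ ∫⁻ x in Metric.closedBall 0 1, ∫⁻ s in Ioc (0 : ℝ) 2, u (y + s • x) := by
        simpa using mul_meas_ge_le_lintegral
          (μ := volume.restrict (Metric.closedBall (0 : EuclideanSpace ℝ (Fin n)) 1))
          (hmeas.lintegral_prod_right' (ν := volume.restrict (Ioc (0 : ℝ) 2))) 1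
    _ = ∫⁻ s in Ioc (0 : ℝ) 2, ∫⁻ x in Metric.closedBall 0 1, u (y + s • x) :=
        lintegral_lintegral_swap hmeas.aemeasurable
    _ ≤ ∫⁻ s in Ioc (0 : ℝ) 2, ENNReal.ofReal δ *
          (volume (Metric.closedBall (0 : EuclideanSpace ℝ (Fin n)) 1) + 1) *
          ENNReal.ofReal (s ^ ((n : ℝ)⁻¹ - 1)) :=
        setLIntegral_mono' measurableSet_Ioc fun s hs =>
          lintegral_unitBall_comp_le hn y hδ0 hs.1 (hcon s hs)
    _ = ENNReal.ofReal δ * M := by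
        rw [lintegral_const_mul _ (by fun_prop), hM, mul_assoc]

/-- Kallunki–Koskela. For each `n` and `a > 0` there is a constant
`c = c(n, a) > 0` such that: if `u : ℝⁿ → [0,∞]` is Borel and `F ⊆ ℝⁿ` is a continuum such
that each `y ∈ F` admits a set `D_y ⊆ S^{n-1}(y, 1)` with `H^{n-1}(D_y) ≥ a` and
`∫_{[y,w]} u ds ≥ 1` for every `w ∈ D_y`, then `∫ uⁿ ≥ c · diam F`. -/
theorem stmt_15 (n : ℕ) (a : ℝ≥0∞) (ha : 0 < a) :
    ∃ c : ℝ≥0∞, 0 < c ∧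
      ∀ (u : EuclideanSpace ℝ (Fin n) → ℝ≥0∞), Measurable u →
        ∀ F : Set (EuclideanSpace ℝ (Fin n)), IsCompact F → IsConnected F →
          (∀ y ∈ F, ∃ D ⊆ Metric.sphere y 1,
            a ≤ μH[(n : ℝ) - 1] D ∧
            ∀ w ∈ D, 1 ≤ ∫⁻ t in Set.Icc (0 : ℝ) 1, u (y + t • (w - y))) →
          c * EMetric.diam F ≤ ∫⁻ x, u x ^ n := by
  rcases eq_or_ne n 0 with rfl | hn
  · exact ⟨1, one_pos, fun u _ F _ _ _ => by
      rw [show EMetric.diam F = 0 from Metric.ediam_subsingleton subsingleton_of_subsingleton,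
        mul_zero]
      exact zero_le⟩
  obtain ⟨C, hCt, hC⟩ : ∃ C : ℝ≥0∞, C ≠ ∞ ∧
      (μH[(n : ℝ)] : Measure (EuclideanSpace ℝ (Fin n))) = C • volume := by
    have hHaar : (μH[(n : ℝ)] : Measure (EuclideanSpace ℝ (Fin n))).IsAddHaarMeasure := by
      simpa using isAddHaarMeasure_hausdorffMeasure (E := EuclideanSpace ℝ (Fin n))
    exact ⟨_, ENNReal.coe_ne_top, Measure.isAddLeftInvariant_eq_smul _ _⟩
  have h2t : (2 : ℝ≥0∞) ^ (n : ℝ) * C ≠ ∞ := ENNReal.mul_ne_top (by simp) hCt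
  obtain ⟨ε, hε, hball⟩ := exists_closedBall_lt_lintegral_pow hn (ENNReal.div_pos ha.ne' h2t)
  refine ⟨ENNReal.ofReal ε / 10, ENNReal.div_pos (by simpa using hε) (by simp),
    fun u hu F _ hF hD => ?_⟩
  have hmass : ∀ y ∈ F, ∃ r ∈ Ioc (0 : ℝ) 2, ENNReal.ofReal (ε * r)
      ≤ (volume.withDensity fun x => u x ^ n) (Metric.closedBall y r) := by
    intro y hy
    obtain ⟨D, hDs, haD, hDu⟩ := hD y hy
    obtain ⟨r, hr, hlt⟩ := hball u hu y <| by
      have hA : (IsometryEquiv.subRight y) '' D ⊆ Metric.sphere 0 1 := by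
        rintro _ ⟨w, hw, rfl⟩
        simpa [dist_eq_norm] using hDs hw
      have hn1 : 0 ≤ (n : ℝ) - 1 := by
        simpa using Nat.one_le_iff_ne_zero.2 hn
      have hcone := hausdorffMeasure_le_cone hn1 hA
      rw [IsometryEquiv.hausdorffMeasure_image, sub_add_cancel, hC, Measure.smul_apply,
        smul_eq_mul, ← mul_assoc] at hcone
      refine ENNReal.div_le_of_le_mul' ((haD.trans hcone).trans ?_)
      refine mul_le_mul_right (measure_mono fun x hx => ?_) _
      obtain ⟨t, ht, _, ⟨w, hw, rfl⟩, rfl⟩ := hx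
      refine ⟨?_, (hDu w hw).trans (lintegral_segment_le_lintegral_ray u y (w - y) ht)⟩
      have hw1 : ‖w - y‖ = 1 := by simpa [dist_eq_norm] using hDs hw
      have ht0 : 0 < t := by linarith [ht.1]
      simpa [norm_smul, hw1, abs_of_pos ht0] using ht.2.le
    refine ⟨r, hr, ?_⟩
    rw [withDensity_apply _ Metric.isClosed_closedBall.measurableSet]
    exact hlt.le
  have h := hF.isPreconnected.mul_ediam_le_measure_univ _ hε.le hmass
  rw [withDensity_apply _ MeasurableSet.univ, Measure.restrict_univ] at h
  rw [ENNReal.mul_comm_div, ← mul_div_assoc]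
  exact ENNReal.div_le_of_le_mul' h
end

section
/- Let p ≥ 1, λ > 0, let {B_i}_{i∈ℕ} be a collection of balls in ℝⁿ, and let a_i ≥ 0 be a sequence of nonnegative numbers. Then ‖Σ_i a_i 𝟙_{λB_i}‖_{L^p(ℝⁿ)} ≤ c(n, p, λ) · ‖Σ_i a_i 𝟙_{B_i}‖_{L^p(ℝⁿ)} for a constant c(n,p,λ) depending only on n, p, λ. -/
open MeasureTheory Set
open scoped ENNReal

section MeasureSpace

variable {α : Type*} [MeasurableSpace α] {μ ν : Measure α}

theorem lintegral_rpow_ne_top_of_le_indicator {f : α → ℝ≥0∞} {U : Set α} {K : ℝ≥0∞} {q : ℝ}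
    (hU : MeasurableSet U) (hμU : μ U ≠ ⊤) (hK : K ≠ ⊤) (hq : 0 < q)
    (hf : ∀ x, f x ≤ U.indicator (fun _ => K) x) : ∫⁻ x, f x ^ q ∂μ ≠ ⊤ := by
  have hle : ∫⁻ x, f x ^ q ∂μ ≤ ∫⁻ x, U.indicator (fun _ => K ^ q) x ∂μ := by
    refine lintegral_mono fun x => ?_
    by_cases hx : x ∈ U
    · simpa [hx] using ENNReal.rpow_le_rpow (hf x) hq.le
    · simpa [hx, hq, hq.not_gt] using hf x
  refine ne_top_of_le_ne_top ?_ hle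
  rw [lintegral_indicator_const hU]
  exact ENNReal.mul_ne_top (ENNReal.rpow_ne_top_of_nonneg hq.le hK) hμU

/-- A Doob-type weak estimate integrates, by the layer cake formula, to a strong one. -/
theorem lintegral_rpow_le_of_mul_meas_lt_le {f : α → ℝ≥0∞} (hf : Measurable f)
    (hf_top : ∀ x, f x ≠ ⊤) {K : ℝ≥0∞} {q : ℝ} (hq : 1 < q)
    (h : ∀ t : ℝ, 0 < t →
      ENNReal.ofReal t * μ {x | ENNReal.ofReal t < f x} ≤ K * ν {x | ENNReal.ofReal t < f x}) :
    ∫⁻ x, f x ^ q ∂μ ≤ K * ENNReal.ofReal (q / (q - 1)) * ∫⁻ x, f x ^ (q - 1) ∂ν := by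
  have hq1 : 0 < q - 1 := by linarith
  have hmeas : Measurable fun x => (f x).toReal := hf.ennreal_toReal
  have hrpow (s : ℝ) (hs : 0 < s) (x : α) :
      f x ^ s = ENNReal.ofReal ((f x).toReal ^ s) := by
    rw [← ENNReal.ofReal_rpow_of_nonneg ENNReal.toReal_nonneg hs.le,
      ENNReal.ofReal_toReal (hf_top x)]
  have hset (t : ℝ) (ht : 0 < t) :
      {x | t < (f x).toReal} = {x | ENNReal.ofReal t < f x} := by
    ext x
    exact (ENNReal.ofReal_lt_iff_lt_toReal ht.le (hf_top x)).symm
  simp_rw [hrpow q (by linarith), hrpow (q - 1) hq1]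
  rw [lintegral_rpow_eq_lintegral_meas_lt_mul μ (.of_forall fun _ => ENNReal.toReal_nonneg)
      hmeas.aemeasurable (by linarith),
    lintegral_rpow_eq_lintegral_meas_lt_mul ν (.of_forall fun _ => ENNReal.toReal_nonneg)
      hmeas.aemeasurable hq1]
  have hanti : Measurable fun t : ℝ => ν {x | t < (f x).toReal} :=
    Antitone.measurable fun s t hst => measure_mono fun x hx => lt_of_le_of_lt hst hx
  calc
    _ ≤ ENNReal.ofReal q * ∫⁻ t in Ioi (0 : ℝ),
        K * (ν {x | t < (f x).toReal} * ENNReal.ofReal (t ^ (q - 1 - 1))) := by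
      refine mul_le_mul_right ?_ _
      refine setLIntegral_mono' measurableSet_Ioi fun t (ht : 0 < t) => ?_
      have hpow : t ^ (q - 1) = t * t ^ (q - 1 - 1) := by
        rw [Real.rpow_sub_one ht.ne' (q - 1)]
        field_simp
      rw [hpow, ENNReal.ofReal_mul ht.le, hset t ht, ← mul_assoc, ← mul_assoc,
        mul_comm (μ _)]
      exact mul_le_mul_left (h t ht) _
    _ = ENNReal.ofReal q * (K * ∫⁻ t in Ioi (0 : ℝ),
        ν {x | t < (f x).toReal} * ENNReal.ofReal (t ^ (q - 1 - 1))) := by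
      rw [lintegral_const_mul]
      exact hanti.mul (by fun_prop)
    _ = _ := by
      have hqq : ENNReal.ofReal q = ENNReal.ofReal (q / (q - 1)) * ENNReal.ofReal (q - 1) := by
        rw [← ENNReal.ofReal_mul (by positivity)]
        congr 1
        field_simp
      rw [hqq]
      ring

end MeasureSpace

theorem ENNReal.rpow_le_mul_of_le_mul_rpow {p q : ℝ} (hpq : p.HolderConjugate q) {X Y : ℝ≥0∞}
    (hX : X ≠ ⊤) (h : X ≤ Y * X ^ (1 / q)) : X ^ (1 / p) ≤ Y := by
  have hp := hpq.pos
  have hq := hpq.symm.pos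
  rcases eq_or_ne X 0 with rfl | hX0
  · simp [ENNReal.zero_rpow_of_pos (inv_pos.2 hp)]
  have hsplit : X = X ^ (1 / p) * X ^ (1 / q) := by
    rw [← ENNReal.rpow_add _ _ hX0 hX, one_div, one_div, hpq.inv_add_inv_eq_one,
      ENNReal.rpow_one]
  have hne0 : X ^ (1 / q) ≠ 0 := by simp [ENNReal.rpow_eq_zero_iff, hX0, hX]
  have hnetop : X ^ (1 / q) ≠ ⊤ := ENNReal.rpow_ne_top_of_nonneg (by positivity) hX
  rw [← ENNReal.mul_le_mul_iff_left hne0 hnetop, ← hsplit]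
  exact h

section PseudoMetricSpace

open Metric

variable {E ι : Type*} [PseudoMetricSpace E]

theorem sum_indicator_ball_le_indicator (s : Finset ι) (c : ι → E) (r : ι → ℝ) (a : ι → ℝ≥0∞)
    (x : E) :
    ∑ i ∈ s, a i * (ball (c i) (r i)).indicator (fun _ => (1 : ℝ≥0∞)) x ≤
      (⋃ i ∈ s, ball (c i) (r i)).indicator (fun _ => ∑ i ∈ s, a i) x := by
  by_cases hx : x ∈ ⋃ i ∈ s, ball (c i) (r i)
  · rw [indicator_of_mem hx]
    gcongr with i
    exact mul_le_of_le_one_right' (indicator_le_self' (by simp) x)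
  · rw [indicator_of_notMem hx, nonpos_iff_eq_zero]
    refine Finset.sum_eq_zero fun i hi => ?_
    have hxi : x ∉ ball (c i) (r i) := fun h => hx (mem_iUnion₂_of_mem hi h)
    rw [indicator_of_notMem hxi, mul_zero]

variable [MeasurableSpace E] (μ : Measure E)

/-- The maximal function of `g` over the finitely many balls `ball (c i) (r i)`, `i ∈ s`. -/
noncomputable def ballMaximal (s : Finset ι) (c : ι → E) (r : ι → ℝ) (g : E → ℝ≥0∞) (x : E) :
    ℝ≥0∞ :=
  ⨆ i ∈ s, (ball (c i) (r i)).indicator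
    (fun _ => (∫⁻ y in ball (c i) (r i), g y ∂μ) / μ (ball (c i) (r i))) x

theorem setOf_lt_ballMaximal (s : Finset ι) (c : ι → E) (r : ι → ℝ) (g : E → ℝ≥0∞) (t : ℝ≥0∞) :
    {x | t < ballMaximal μ s c r g x} = ⋃ i ∈ ({i ∈ s | t < (∫⁻ y in ball (c i) (r i), g y ∂μ) /
      μ (ball (c i) (r i))} : Finset ι), ball (c i) (r i) := by
  ext x
  simp only [ballMaximal, mem_ofPred_eq, lt_iSup_iff, Finset.mem_filter, mem_iUnion,
    exists_prop, and_assoc]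
  refine exists_congr fun i => and_congr_right fun _ => ?_
  by_cases hx : x ∈ ball (c i) (r i) <;> simp [hx]

variable {μ} in
theorem exists_ballMaximal_le_indicator [μ.IsOpenPosMeasure] (s : Finset ι) (c : ι → E) (r : ι → ℝ)
    {g : E → ℝ≥0∞} (hg : ∀ i ∈ s, ∫⁻ y in ball (c i) (r i), g y ∂μ ≠ ⊤) :
    ∃ K : ℝ≥0∞, K ≠ ⊤ ∧ ∀ x, ballMaximal μ s c r g x ≤
      (⋃ i ∈ s, ball (c i) (r i)).indicator (fun _ => K) x := by
  refine ⟨∑ i ∈ s, (∫⁻ y in ball (c i) (r i), g y ∂μ) / μ (ball (c i) (r i)), ?_, fun x => ?_⟩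
  · refine ENNReal.sum_ne_top.2 fun i hi => ?_
    rcases le_or_gt (r i) 0 with hr | hr
    · simp [ball_eq_empty.2 hr]
    · exact ENNReal.div_ne_top (hg i hi) (measure_ball_pos μ _ hr).ne'
  · refine iSup₂_le fun i hi => ?_
    by_cases hx : x ∈ ball (c i) (r i)
    · rw [indicator_of_mem hx, indicator_of_mem (mem_iUnion₂_of_mem hi hx)]
      exact Finset.single_le_sum_of_canonicallyOrdered
        (f := fun i => (∫⁻ y in ball (c i) (r i), g y ∂μ) / μ (ball (c i) (r i))) hi
    · exact (indicator_of_notMem hx _).trans_le zero_le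

variable [OpensMeasurableSpace E]

theorem measurable_ballMaximal (s : Finset ι) (c : ι → E) (r : ι → ℝ) (g : E → ℝ≥0∞) :
    Measurable (ballMaximal μ s c r g) := by
  unfold ballMaximal
  exact .biSup _ s.countable_toSet fun i _ => measurable_const.indicator measurableSet_ball

theorem lintegral_sum_indicator_ball_mul (s : Finset ι) (c : ι → E) (r : ι → ℝ) (a : ι → ℝ≥0∞)
    {g : E → ℝ≥0∞} (hg : Measurable g) :
    ∫⁻ x, (∑ i ∈ s, a i * (ball (c i) (r i)).indicator (fun _ => 1) x) * g x ∂μ =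
      ∑ i ∈ s, a i * ∫⁻ x in ball (c i) (r i), g x ∂μ := by
  simp_rw [Finset.sum_mul]
  rw [lintegral_finsetSum]
  · refine Finset.sum_congr rfl fun i _ => ?_
    simp_rw [mul_assoc]
    rw [lintegral_const_mul _ (by fun_prop (disch := exact measurableSet_ball)),
      ← lintegral_indicator measurableSet_ball]
    congr 2 with x
    by_cases hx : x ∈ ball (c i) (r i) <;> simp [hx]
  · exact fun i _ => (measurable_const.mul
      (measurable_const.indicator measurableSet_ball)).mul hg

theorem lintegral_sum_indicator_ball (s : Finset ι) (c : ι → E) (r : ι → ℝ) (a : ι → ℝ≥0∞) :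
    ∫⁻ x, (∑ i ∈ s, a i * (ball (c i) (r i)).indicator (fun _ => 1) x) ∂μ =
      ∑ i ∈ s, a i * μ (ball (c i) (r i)) := by
  simpa using lintegral_sum_indicator_ball_mul μ s c r a (g := fun _ => 1) measurable_const

end PseudoMetricSpace

section Balls

open Metric Module

variable {E ι : Type*} [NormedAddCommGroup E] [NormedSpace ℝ E] [FiniteDimensional ℝ E]
  [MeasurableSpace E] [BorelSpace E] (μ : Measure E) [μ.IsAddHaarMeasure]

theorem measure_ball_mul_le (x : E) {k : ℝ} (hk : 0 < k) (r : ℝ) :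
    μ (ball x (k * r)) = ENNReal.ofReal (k ^ finrank ℝ E) * μ (ball x r) := by
  rw [Measure.addHaar_ball_mul_of_pos μ x hk, Measure.addHaar_ball_center μ x]

theorem mul_measure_biUnion_ball_le (ν : Measure E) (s : Finset ι) (c : ι → E) (r : ι → ℝ)
    (t : ℝ≥0∞) (h : ∀ i ∈ s, t * μ (ball (c i) (r i)) ≤ ν (ball (c i) (r i))) :
    t * μ (⋃ i ∈ s, ball (c i) (r i)) ≤
      ENNReal.ofReal (4 ^ finrank ℝ E) * ν (⋃ i ∈ s, ball (c i) (r i)) := by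
  obtain ⟨R, hR⟩ := (s.finite_toSet.image r).bddAbove
  obtain ⟨u, hus, hdisj, hcov⟩ := Vitali.exists_disjoint_subfamily_covering_enlargement_ball
    (s : Set ι) c r R (fun i hi => hR (mem_image_of_mem r hi)) 4 (by norm_num)
  lift u to Finset ι using s.finite_toSet.subset hus
  have hcov' : ⋃ i ∈ s, ball (c i) (r i) ⊆ ⋃ i ∈ u, ball (c i) (4 * r i) := by
    refine iUnion₂_subset fun i hi => ?_
    obtain ⟨j, hj, hij⟩ := hcov i hi
    exact hij.trans (subset_biUnion_of_mem (u := fun i => ball (c i) (4 * r i)) hj)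
  calc
    _ ≤ t * ∑ i ∈ u, μ (ball (c i) (4 * r i)) := by
      gcongr
      exact (measure_mono hcov').trans (measure_biUnion_finset_le _ _)
    _ = ENNReal.ofReal (4 ^ finrank ℝ E) * ∑ i ∈ u, t * μ (ball (c i) (r i)) := by
      simp_rw [measure_ball_mul_le μ _ (by norm_num : (0 : ℝ) < 4), Finset.mul_sum]
      exact Finset.sum_congr rfl fun i _ => by ring
    _ ≤ ENNReal.ofReal (4 ^ finrank ℝ E) * ∑ i ∈ u, ν (ball (c i) (r i)) := by
      gcongr with i hi
      exact h i (hus hi)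
    _ = ENNReal.ofReal (4 ^ finrank ℝ E) * ν (⋃ i ∈ u, ball (c i) (r i)) := by
      rw [measure_biUnion_finset hdisj fun i _ => measurableSet_ball]
    _ ≤ _ := by
      exact mul_le_mul_right (measure_mono (biUnion_subset_biUnion_left hus)) _

theorem mul_measure_lt_ballMaximal_le (s : Finset ι) (c : ι → E) (r : ι → ℝ) (g : E → ℝ≥0∞)
    (t : ℝ≥0∞) :
    t * μ {x | t < ballMaximal μ s c r g x} ≤
      ENNReal.ofReal (4 ^ finrank ℝ E) * μ.withDensity g {x | t < ballMaximal μ s c r g x} := by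
  rw [setOf_lt_ballMaximal]
  refine mul_measure_biUnion_ball_le μ _ _ c r t fun i hi => ?_
  rw [withDensity_apply _ measurableSet_ball]
  exact ENNReal.mul_le_of_le_div (Finset.mem_filter.1 hi).2.le

variable {μ} in
/-- The maximal inequality in `L^q`, `q > 1`. -/
theorem lintegral_ballMaximal_rpow_le {p q : ℝ} (hpq : p.HolderConjugate q) (s : Finset ι)
    (c : ι → E) (r : ι → ℝ) {g : E → ℝ≥0∞} (hgm : Measurable g)
    (hg : ∀ i ∈ s, ∫⁻ y in ball (c i) (r i), g y ∂μ ≠ ⊤) :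
    (∫⁻ x, ballMaximal μ s c r g x ^ q ∂μ) ^ (1 / q) ≤
      ENNReal.ofReal (4 ^ finrank ℝ E) * ENNReal.ofReal p * (∫⁻ x, g x ^ q ∂μ) ^ (1 / q) := by
  obtain ⟨K, hK, hMK⟩ := exists_ballMaximal_le_indicator s c r hg
  have hMm := measurable_ballMaximal μ s c r g
  have hM_top (x : E) : ballMaximal μ s c r g x ≠ ⊤ :=
    ne_top_of_le_ne_top hK ((hMK x).trans (indicator_le_self' (by simp) x))
  have hfin : ∫⁻ x, ballMaximal μ s c r g x ^ q ∂μ ≠ ⊤ := by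
    refine lintegral_rpow_ne_top_of_le_indicator
      (s.measurableSet_biUnion fun _ _ => measurableSet_ball) ?_ hK hpq.symm.pos hMK
    exact ((measure_biUnion_finset_le _ _).trans_lt
      (ENNReal.sum_lt_top.2 fun i _ => measure_ball_lt_top)).ne
  refine ENNReal.rpow_le_mul_of_le_mul_rpow hpq.symm hfin ?_
  have hstrong := lintegral_rpow_le_of_mul_meas_lt_le hMm hM_top hpq.symm.lt
    fun t _ => mul_measure_lt_ballMaximal_le μ s c r g (ENNReal.ofReal t)
  rw [← hpq.symm.conjugate_eq, lintegral_withDensity_eq_lintegral_mul _ hgm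
    (hMm.pow_const _)] at hstrong
  refine hstrong.trans ?_
  rw [mul_assoc _ (_ ^ (1 / q))]
  gcongr
  refine (ENNReal.lintegral_mul_le_Lp_mul_Lq μ hpq.symm hgm.aemeasurable
    (hMm.pow_const _).aemeasurable).trans_eq ?_
  simp_rw [← ENNReal.rpow_mul, hpq.symm.sub_one_mul_conj]

theorem setLIntegral_ball_le_mul_setLIntegral_ballMaximal {s : Finset ι} {i : ι} (hi : i ∈ s)
    (c : ι → E) (r : ι → ℝ) {k : ℝ} (hk : 1 ≤ k) (g : E → ℝ≥0∞) :
    ∫⁻ x in ball (c i) (k * r i), g x ∂μ ≤ ENNReal.ofReal (k ^ finrank ℝ E) *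
      ∫⁻ x in ball (c i) (r i), ballMaximal μ s c (fun j => k * r j) g x ∂μ := by
  rcases le_or_gt (r i) 0 with hr | hr
  · simp [ball_eq_empty.2 (mul_nonpos_of_nonneg_of_nonpos (by linarith : 0 ≤ k) hr)]
  have hk0 : 0 < k := by linarith
  set A := (∫⁻ y in ball (c i) (k * r i), g y ∂μ) / μ (ball (c i) (k * r i)) with hA
  have hsub : ball (c i) (r i) ⊆ ball (c i) (k * r i) :=
    ball_subset_ball (le_mul_of_one_le_left hr.le hk)
  have hAM : A * μ (ball (c i) (r i)) ≤
      ∫⁻ x in ball (c i) (r i), ballMaximal μ s c (fun j => k * r j) g x ∂μ := by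
    rw [← setLIntegral_const]
    refine setLIntegral_mono' measurableSet_ball fun x hx => ?_
    have hle := le_iSup₂ (f := fun j (_ : j ∈ s) => (ball (c j) (k * r j)).indicator
      (fun _ => (∫⁻ y in ball (c j) (k * r j), g y ∂μ) / μ (ball (c j) (k * r j))) x) i hi
    rw [indicator_of_mem (hsub hx)] at hle
    exact hle
  calc
    _ = A * μ (ball (c i) (k * r i)) := by
      rw [hA, ENNReal.div_mul_cancel (measure_ball_pos μ _ (by positivity)).ne'
        measure_ball_lt_top.ne]
    _ = ENNReal.ofReal (k ^ finrank ℝ E) * (A * μ (ball (c i) (r i))) := by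
      rw [measure_ball_mul_le μ _ hk0]
      ring
    _ ≤ _ := by gcongr

/-- Bojarski's inequality for finitely many balls. -/
theorem bojarski_finset {p k : ℝ} (hp : 1 ≤ p) (hk : 1 ≤ k) (s : Finset ι) (c : ι → E)
    (r : ι → ℝ) (a : ι → ℝ≥0∞) (ha : ∀ i ∈ s, a i ≠ ⊤) :
    (∫⁻ x, (∑ i ∈ s, a i * (ball (c i) (k * r i)).indicator (fun _ => (1 : ℝ≥0∞)) x) ^ p ∂μ) ^
        (1 / p) ≤
      ENNReal.ofReal (k ^ finrank ℝ E) * (ENNReal.ofReal (4 ^ finrank ℝ E) * ENNReal.ofReal p) *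
        (∫⁻ x, (∑ i ∈ s, a i * (ball (c i) (r i)).indicator (fun _ => (1 : ℝ≥0∞)) x) ^ p ∂μ) ^
          (1 / p) := by
  have hk0 : 0 < k := by linarith
  rcases hp.eq_or_lt with rfl | hp1
  · simp only [ENNReal.rpow_one, div_one, lintegral_sum_indicator_ball,
      measure_ball_mul_le μ _ hk0, ENNReal.ofReal_one, mul_one]
    have h4 : 1 ≤ ENNReal.ofReal (4 ^ finrank ℝ E) :=
      ENNReal.one_le_ofReal.2 (one_le_pow₀ (by norm_num))
    calc
      _ = ENNReal.ofReal (k ^ finrank ℝ E) * 1 * ∑ i ∈ s, a i * μ (ball (c i) (r i)) := by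
        rw [mul_one, Finset.mul_sum]
        exact Finset.sum_congr rfl fun i _ => by ring
      _ ≤ _ := by gcongr
  have hpq := Real.HolderConjugate.conjExponent hp1
  set q := p.conjExponent
  have hmeas (ρ : ι → ℝ) : Measurable fun x =>
      ∑ i ∈ s, a i * (ball (c i) (ρ i)).indicator (fun _ => (1 : ℝ≥0∞)) x :=
    Finset.measurable_sum _ fun i _ =>
      measurable_const.mul (measurable_const.indicator measurableSet_ball)
  set S : E → ℝ≥0∞ := fun x =>
    ∑ i ∈ s, a i * (ball (c i) (k * r i)).indicator (fun _ => (1 : ℝ≥0∞)) x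
  set f : E → ℝ≥0∞ := fun x =>
    ∑ i ∈ s, a i * (ball (c i) (r i)).indicator (fun _ => (1 : ℝ≥0∞)) x with hf
  have hSm : Measurable S := hmeas _
  have hSle := sum_indicator_ball_le_indicator s c (fun i => k * r i) a
  have ha_sum : ∑ i ∈ s, a i ≠ ⊤ := ENNReal.sum_ne_top.2 ha
  have hU : μ (⋃ i ∈ s, ball (c i) (k * r i)) ≠ ⊤ :=
    ((measure_biUnion_finset_le _ _).trans_lt
      (ENNReal.sum_lt_top.2 fun i _ => measure_ball_lt_top)).ne
  have hUm : MeasurableSet (⋃ i ∈ s, ball (c i) (k * r i)) :=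
    s.measurableSet_biUnion fun _ _ => measurableSet_ball
  set M := ballMaximal μ s c (fun i => k * r i) fun x => S x ^ (p - 1)
  have hMm : Measurable M := measurable_ballMaximal ..
  refine ENNReal.rpow_le_mul_of_le_mul_rpow hpq
    (lintegral_rpow_ne_top_of_le_indicator hUm hU ha_sum hpq.pos hSle) ?_
  have hmax : (∫⁻ x, M x ^ q ∂μ) ^ (1 / q) ≤ ENNReal.ofReal (4 ^ finrank ℝ E) *
      ENNReal.ofReal p * (∫⁻ x, S x ^ p ∂μ) ^ (1 / q) := by
    have hmax := lintegral_ballMaximal_rpow_le (μ := μ) hpq s c (fun i => k * r i)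
      (hSm.pow_const (p - 1)) fun i _ => ne_top_of_le_ne_top
        (lintegral_rpow_ne_top_of_le_indicator hUm hU ha_sum hpq.sub_one_pos hSle)
        (setLIntegral_le_lintegral _ _)
    simpa only [← ENNReal.rpow_mul, hpq.sub_one_mul_conj] using hmax
  calc
    ∫⁻ x, S x ^ p ∂μ = ∫⁻ x, S x * S x ^ (p - 1) ∂μ := by
      congr with x
      nth_rw 2 [← ENNReal.rpow_one (S x)]
      rw [← ENNReal.rpow_add_of_nonneg _ _ zero_le_one hpq.sub_one_pos.le, add_sub_cancel]
    _ = ∑ i ∈ s, a i * ∫⁻ x in ball (c i) (k * r i), S x ^ (p - 1) ∂μ :=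
      lintegral_sum_indicator_ball_mul μ s c _ a (hSm.pow_const _)
    _ ≤ ∑ i ∈ s, a i * (ENNReal.ofReal (k ^ finrank ℝ E) *
        ∫⁻ x in ball (c i) (r i), M x ∂μ) := by
      gcongr with i hi
      exact setLIntegral_ball_le_mul_setLIntegral_ballMaximal μ hi c r hk _
    _ = ENNReal.ofReal (k ^ finrank ℝ E) * ∫⁻ x, (f * M) x ∂μ := by
      simp only [Pi.mul_apply, hf]
      rw [lintegral_sum_indicator_ball_mul μ s c r a hMm, Finset.mul_sum]
      exact Finset.sum_congr rfl fun i _ => by ring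
    _ ≤ ENNReal.ofReal (k ^ finrank ℝ E) * ((∫⁻ x, f x ^ p ∂μ) ^ (1 / p) *
        (ENNReal.ofReal (4 ^ finrank ℝ E) * ENNReal.ofReal p *
          (∫⁻ x, S x ^ p ∂μ) ^ (1 / q))) := by
      gcongr
      exact (ENNReal.lintegral_mul_le_Lp_mul_Lq μ hpq (hmeas r).aemeasurable
        hMm.aemeasurable).trans (by gcongr)
    _ = _ := by ring

/-- Bojarski's inequality for a sequence of balls, with dilation factor at least one. -/
theorem bojarski_of_one_le {p k : ℝ} (hp : 1 ≤ p) (hk : 1 ≤ k) (c : ℕ → E) (r : ℕ → ℝ)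
    (a : ℕ → ℝ≥0∞) :
    (∫⁻ x, (∑' i, a i * (ball (c i) (k * r i)).indicator (fun _ => (1 : ℝ≥0∞)) x) ^ p ∂μ) ^
        (1 / p) ≤
      ENNReal.ofReal (k ^ finrank ℝ E) * (ENNReal.ofReal (4 ^ finrank ℝ E) * ENNReal.ofReal p) *
        (∫⁻ x, (∑' i, a i * (ball (c i) (r i)).indicator (fun _ => (1 : ℝ≥0∞)) x) ^ p ∂μ) ^
          (1 / p) := by
  have hp0 : 0 < p := by linarith
  have hk0 : 0 < k := by linarith
  by_cases htop : ∃ i, a i = ⊤ ∧ 0 < r i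
  · obtain ⟨i, hai, hri⟩ := htop
    have hnorm_top : ∫⁻ x, (∑' i, a i * (ball (c i) (r i)).indicator (fun _ => (1 : ℝ≥0∞)) x) ^ p ∂μ
        = ⊤ := by
      refine top_unique ?_
      calc
        (⊤ : ℝ≥0∞) = ∫⁻ _ in ball (c i) (r i), ⊤ ∂μ := by
          rw [setLIntegral_const, ENNReal.top_mul (measure_ball_pos μ _ hri).ne']
        _ ≤ ∫⁻ x in ball (c i) (r i),
            (∑' i, a i * (ball (c i) (r i)).indicator (fun _ => (1 : ℝ≥0∞)) x) ^ p ∂μ := by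
          refine setLIntegral_mono' measurableSet_ball fun x hx => ?_
          have hle := ENNReal.le_tsum
            (f := fun i => a i * (ball (c i) (r i)).indicator (fun _ => (1 : ℝ≥0∞)) x) i
          rw [indicator_of_mem hx, hai, mul_one, top_le_iff] at hle
          rw [hle, ENNReal.top_rpow_of_pos hp0]
        _ ≤ _ := setLIntegral_le_lintegral _ _
    rw [hnorm_top, ENNReal.top_rpow_of_pos (by positivity), ENNReal.mul_top]
    · exact le_top
    · have h1 : 0 < k ^ finrank ℝ E := by positivity
      simp [h1, hp0]
  push Not at htop
  have hfinset (N : ℕ) :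
      (∫⁻ x, (∑ i ∈ Finset.range N,
        a i * (ball (c i) (k * r i)).indicator (fun _ => (1 : ℝ≥0∞)) x) ^ p ∂μ) ^ (1 / p) ≤
      ENNReal.ofReal (k ^ finrank ℝ E) * (ENNReal.ofReal (4 ^ finrank ℝ E) * ENNReal.ofReal p) *
        (∫⁻ x, (∑' i, a i * (ball (c i) (r i)).indicator (fun _ => (1 : ℝ≥0∞)) x) ^ p ∂μ) ^
          (1 / p) := by
    have hsub (ρ : ℕ → ℝ) (hρ : ∀ i, r i ≤ 0 → ρ i ≤ 0) (x : E) :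
        ∑ i ∈ Finset.range N, a i * (ball (c i) (ρ i)).indicator (fun _ => (1 : ℝ≥0∞)) x =
        ∑ i ∈ Finset.range N with a i ≠ ⊤,
          a i * (ball (c i) (ρ i)).indicator (fun _ => (1 : ℝ≥0∞)) x := by
      refine (Finset.sum_filter_of_ne (p := fun i => a i ≠ ⊤) fun i _ hi hai => hi ?_).symm
      simp [ball_eq_empty.2 (hρ i (htop i hai))]
    simp_rw [hsub (fun i => k * r i) fun i hi => mul_nonpos_of_nonneg_of_nonpos hk0.le hi]
    refine (bojarski_finset μ hp hk _ c r a fun i hi => (Finset.mem_filter.1 hi).2).trans ?_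
    gcongr
    exact ENNReal.sum_le_tsum _
  have hpow (x : E) :
      (∑' i, a i * (ball (c i) (k * r i)).indicator (fun _ => (1 : ℝ≥0∞)) x) ^ p =
      ⨆ N, (∑ i ∈ Finset.range N,
        a i * (ball (c i) (k * r i)).indicator (fun _ => (1 : ℝ≥0∞)) x) ^ p := by
    rw [ENNReal.tsum_eq_iSup_nat]
    exact (ENNReal.orderIsoRpow p hp0).map_iSup _
  simp_rw [hpow]
  rw [lintegral_iSup]
  · rw [one_div, ENNReal.rpow_inv_le_iff hp0]
    refine iSup_le fun N => ?_
    rw [← ENNReal.rpow_inv_le_iff hp0]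
    simpa only [one_div] using hfinset N
  · exact fun N => (Finset.measurable_sum _ fun i _ => measurable_const.mul
      (measurable_const.indicator measurableSet_ball)).pow_const _
  · intro N N' hN x
    exact ENNReal.rpow_le_rpow (Finset.sum_le_sum_of_subset (Finset.range_mono hN)) hp0.le

end Balls

/-- Bojarski's inequality. For `p ≥ 1` and `λ > 0` there is a constant
`C = C(n, p, λ)` such that for any collection of balls `Bᵢ = B(cᵢ, rᵢ)` in `ℝⁿ` and
nonnegative numbers `aᵢ`,
`‖Σᵢ aᵢ 𝟙_{λBᵢ}‖_{L^p} ≤ C · ‖Σᵢ aᵢ 𝟙_{Bᵢ}‖_{L^p}`. -/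
theorem stmt_16 (n : ℕ) (p lam : ℝ) (hp : 1 ≤ p) (hlam : 0 < lam) :
    ∃ C : ℝ≥0∞, 0 < C ∧ C ≠ ⊤ ∧
      ∀ (c : ℕ → EuclideanSpace ℝ (Fin n)) (r : ℕ → ℝ) (a : ℕ → ℝ≥0∞),
        (∫⁻ x, (∑' i, a i *
            (Metric.ball (c i) (lam * r i)).indicator (fun _ => (1 : ℝ≥0∞)) x) ^ p) ^ (1 / p) ≤
          C * (∫⁻ x, (∑' i, a i *
            (Metric.ball (c i) (r i)).indicator (fun _ => (1 : ℝ≥0∞)) x) ^ p) ^ (1 / p) := by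
  have hp0 : 0 < p := by linarith
  have hk : 1 ≤ max lam 1 := le_max_right ..
  have hkn : 0 < max lam 1 ^ Module.finrank ℝ (EuclideanSpace ℝ (Fin n)) := by positivity
  refine ⟨_, ?_, ?_, fun c r a =>
    le_trans ?_ (bojarski_of_one_le volume hp hk c r a)⟩
  · exact ENNReal.mul_pos (by simp) (by simp [hp0])
  · finiteness
  · have hsub (i : ℕ) : Metric.ball (c i) (lam * r i) ⊆ Metric.ball (c i) (max lam 1 * r i) := by
      rcases le_or_gt (r i) 0 with hr | hr
      · simp [Metric.ball_eq_empty.2 (mul_nonpos_of_nonneg_of_nonpos hlam.le hr)]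
      · exact Metric.ball_subset_ball (by gcongr; exact le_max_left ..)
    refine ENNReal.rpow_le_rpow (lintegral_mono fun x => ENNReal.rpow_le_rpow
      (ENNReal.tsum_le_tsum fun i => mul_le_mul_right ?_ _) hp0.le) (by positivity)
    exact indicator_le_indicator_of_subset (f := fun _ => (1 : ℝ≥0∞)) (hsub i)
      (fun _ => zero_le) x
end
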